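/- Let m be an odd prime, r₁, r₂ natural numbers with 3 ≤ r₁ ≤ r₂, and p ∈ {4, 5, 6}. If 4(1 + p) = ((r₁ − 2)(m − 1) − 2)·((r₂ − 2)(m − 1) − 2), then m = 3 or m = 5; moreover, if m = 5 then (p, r₁, r₂) = (4, 3, 5) or (p, r₁, r₂) = (6, 3, 6). -/

import Mathlib

/-- Arithmetic content of Case ii) (`k = 2`, `m` an odd prime) of Section 4.1: if
`4(1+p) = ((r₁-2)(m-1)-2)·((r₂-2)(m-1)-2)` with `p ∈ {4,5,6}` and `3 ≤ r₁ ≤ r₂`,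
then `m = 3` or `m = 5`; and if `m = 5` then `(p,r₁,r₂) = (4,3,5)` or
`(p,r₁,r₂) = (6,3,6)`. -/
theorem isogenous_numerics_k_two
    (m p r₁ r₂ : ℕ) (hm : Nat.Prime m) (hodd : Odd m)
    (hp : p = 4 ∨ p = 5 ∨ p = 6) (hr₁ : 3 ≤ r₁) (hr : r₁ ≤ r₂)
    (heq : 4 * (1 + p) = ((r₁ - 2) * (m - 1) - 2) * ((r₂ - 2) * (m - 1) - 2)) :
    (m = 3 ∨ m = 5) ∧
      (m = 5 → ((p, r₁, r₂) = (4, 3, 5) ∨ (p, r₁, r₂) = (6, 3, 6))) := by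
  obtain ⟨n, rfl⟩ := hodd
  obtain ⟨a, rfl⟩ : ∃ a, r₁ = a + 3 := ⟨r₁ - 3, by omega⟩
  obtain ⟨b, rfl⟩ : ∃ b, r₂ = b + 3 := ⟨r₂ - 3, by omega⟩
  have hab : a ≤ b := by omega
  have hn : 1 ≤ n := by
    rcases Nat.eq_zero_or_pos n with rfl | h
    · exact absurd hm (by norm_num)
    · exact h
  have e1 : (a + 3 - 2) * (2 * n + 1 - 1) = 2 * n + 2 * (a * n) := by
    rw [show a + 3 - 2 = a + 1 by omega, show 2 * n + 1 - 1 = 2 * n by omega]; ring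
  have e2 : (b + 3 - 2) * (2 * n + 1 - 1) = 2 * n + 2 * (b * n) := by
    rw [show b + 3 - 2 = b + 1 by omega, show 2 * n + 1 - 1 = 2 * n by omega]; ring
  rw [e1, e2] at heq
  obtain ⟨k, rfl⟩ : ∃ k, n = k + 1 := ⟨n - 1, by omega⟩
  have e3 : ∀ t, 2 * (k + 1) + 2 * t - 2 = 2 * (k + t) := fun t => by omega
  rw [e3, e3] at heq
  have h : (k + a * (k + 1)) * (k + b * (k + 1)) = 1 + p := by linarith
  have hk : k ≤ 2 := by
    by_contra hk
    have : 3 * 3 ≤ (k + a * (k + 1)) * (k + b * (k + 1)) :=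
      Nat.mul_le_mul (le_add_right (by omega)) (le_add_right (by omega))
    omega
  interval_cases k
  · simp
  · have ha : a = 0 := by
      by_contra ha
      have : 3 * 3 ≤ (1 + a * (1 + 1)) * (1 + b * (1 + 1)) :=
        Nat.mul_le_mul (by omega) (by omega)
      omega
    subst ha
    refine ⟨by omega, fun _ => ?_⟩
    rcases hp with rfl | rfl | rfl
    · left
      have hb : b = 2 := by omega
      subst hb
      rfl
    · omega
    · right
      have hb : b = 3 := by omega
      subst hb
      rfl
  · exfalso
    have ha : a = 0 := by
      by_contra ha
      have : 5 * 5 ≤ (2 + a * (2 + 1)) * (2 + b * (2 + 1)) :=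
        Nat.mul_le_mul (by omega) (by omega)
      omega
    subst ha
    omega
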